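/- Let λ, t_p, t_j, t_q ∈ ℂ and assume that ϑ₁(λ), ϑ₁(λ−t_p+t_q), ϑ₁(t_p−t_j), ϑ₁(t_j−t_q), ϑ₁(t_p−t_q−λ) and ϑ₁(t_p−t_q) are all nonzero. Then ϑ₁′(0)·ϑ₁(λ−t_p+t_j)·ϑ₁(λ−t_j+t_q)·ϑ₁(t_p−t_q) / (ϑ₁(λ)·ϑ₁(λ−t_p+t_q)·ϑ₁(t_p−t_j)·ϑ₁(t_j−t_q)) = ρ(t_p−t_j) + ρ(t_j−t_q) − ρ(t_p−t_q−λ) − ρ(λ). -/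

import Mathlib

open Complex Filter

/-- The theta function ϑ₁(u,τ). -/
noncomputable def theta (τ u : ℂ) : ℂ :=
  -∑' m : ℤ, Complex.exp ((Real.pi : ℂ) * Complex.I * (m + 1/2)^2 * τ +
    2 * (Real.pi : ℂ) * Complex.I * (m + 1/2) * (u + 1/2))

/-- Derivative ϑ₁′ in u. -/
noncomputable def theta' (τ : ℂ) : ℂ → ℂ := deriv (theta τ)

/-- ρ(u) = ϑ₁′(u)/ϑ₁(u). -/
noncomputable def rho (τ u : ℂ) : ℂ := theta' τ u / theta τ u

/-- 𝔰(u;λ) = ϑ₁(u−λ)ϑ₁′(0)/(ϑ₁(u)ϑ₁(−λ)). -/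
noncomputable def fraks (τ u lam : ℂ) : ℂ :=
  theta τ (u - lam) * theta' τ 0 / (theta τ u * theta τ (-lam))

/-- The even-index part of the theta series of modulus `τ / 2`. -/
noncomputable def thetaEven (τ x : ℂ) : ℂ := ∑' k : ℤ, jacobiTheta₂_term (2 * k) x (τ / 2)

/-- The odd-index part of the theta series of modulus `τ / 2`. -/
noncomputable def thetaOdd (τ x : ℂ) : ℂ := ∑' k : ℤ, jacobiTheta₂_term (2 * k + 1) x (τ / 2)

/-- The general term of the series defining `theta`. -/
noncomputable def thetaTerm (τ u : ℂ) (m : ℤ) : ℂ :=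
  Complex.exp ((Real.pi : ℂ) * Complex.I * (m + 1/2)^2 * τ +
    2 * (Real.pi : ℂ) * Complex.I * (m + 1/2) * (u + 1/2))

theorem thetaTerm_eq (τ u : ℂ) (m : ℤ) :
    thetaTerm τ u m = Complex.exp (Real.pi * I * τ / 4 + Real.pi * I * (u + 1/2)) *
      jacobiTheta₂_term m (u + 1/2 + τ / 2) τ := by
  rw [thetaTerm, jacobiTheta₂_term, ← Complex.exp_add]
  congr 1
  ring

theorem theta_eq_neg_tsum (τ u : ℂ) : theta τ u = -∑' m, thetaTerm τ u m := rfl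

theorem theta_eq_jacobiTheta₂ (τ u : ℂ) :
    theta τ u = -(Complex.exp (Real.pi * I * τ / 4 + Real.pi * I * (u + 1/2)) *
      jacobiTheta₂ (u + 1/2 + τ / 2) τ) := by
  simp_rw [theta_eq_neg_tsum, thetaTerm_eq, tsum_mul_left, jacobiTheta₂]

theorem summable_thetaTerm {τ : ℂ} (hτ : 0 < τ.im) (u : ℂ) : Summable (thetaTerm τ u) := by
  rw [funext (thetaTerm_eq τ u)]
  exact ((summable_jacobiTheta₂_term_iff _ _).2 hτ).mul_left _

theorem differentiable_theta {τ : ℂ} (hτ : 0 < τ.im) : Differentiable ℂ (theta τ) := by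
  intro u
  rw [funext (theta_eq_jacobiTheta₂ τ)]
  have h : DifferentiableAt ℂ (fun u : ℂ => jacobiTheta₂ (u + 1/2 + τ / 2) τ) u :=
    (differentiableAt_jacobiTheta₂_fst (u + 1/2 + τ / 2) hτ).comp u
      (f := fun u : ℂ => u + 1/2 + τ / 2) (by fun_prop)
  fun_prop

/-- The change of indices `(m, n) ↦ (m + n + 1, m - n)`, split by the parity of `m + n + 1`. -/
def thetaIndexEquiv : (ℤ × ℤ) ⊕ (ℤ × ℤ) ≃ ℤ × ℤ where
  toFun := Sum.elim (fun p => (p.1 + p.2, p.1 - p.2 - 1)) (fun p => (p.1 + p.2, p.1 - p.2))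
  invFun p := if (p.1 + p.2) % 2 = 0 then .inr ((p.1 + p.2) / 2, (p.1 - p.2) / 2)
    else .inl ((p.1 + p.2 + 1) / 2, (p.1 - p.2 - 1) / 2)
  left_inv := by
    rintro (⟨k, l⟩ | ⟨k, l⟩) <;> dsimp only [Sum.elim_inl, Sum.elim_inr]
    · rw [if_neg (by omega)]
      congr 2 <;> omega
    · rw [if_pos (by omega)]
      congr 2 <;> omega
  right_inv := by
    rintro ⟨m, n⟩
    dsimp only
    split_ifs <;> simp only [Sum.elim_inl, Sum.elim_inr, Prod.mk.injEq] <;> omega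

theorem thetaTerm_mul_of_even_add (τ x y : ℂ) (k l : ℤ) :
    thetaTerm τ (x + y) (k + l) * thetaTerm τ (x - y) (k - l - 1) =
      jacobiTheta₂_term (2 * k) x (τ / 2) * jacobiTheta₂_term (2 * l + 1) y (τ / 2) := by
  simp only [thetaTerm, jacobiTheta₂_term, ← Complex.exp_add]
  rw [Complex.exp_eq_exp_iff_exists_int]
  refine ⟨k, ?_⟩
  push_cast
  ring

theorem thetaTerm_mul_of_odd_add (τ x y : ℂ) (k l : ℤ) :
    thetaTerm τ (x + y) (k + l) * thetaTerm τ (x - y) (k - l) =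
      -(jacobiTheta₂_term (2 * k + 1) x (τ / 2) * jacobiTheta₂_term (2 * l) y (τ / 2)) := by
  simp only [thetaTerm, jacobiTheta₂_term, ← Complex.exp_add]
  rw [← mul_neg_one, ← Complex.exp_pi_mul_I, ← Complex.exp_add, Complex.exp_eq_exp_iff_exists_int]
  refine ⟨k, ?_⟩
  push_cast
  ring

theorem theta_add_mul_theta_sub {τ : ℂ} (hτ : 0 < τ.im) (x y : ℂ) :
    theta τ (x + y) * theta τ (x - y) =
      thetaEven τ x * thetaOdd τ y - thetaOdd τ x * thetaEven τ y := by
  have hτ2 : 0 < (τ / 2).im := by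
    rw [Complex.div_ofNat_im]
    positivity
  have hs (z : ℂ) := (summable_jacobiTheta₂_term_iff z (τ / 2)).2 hτ2
  have he (z : ℂ) : Summable fun k : ℤ => ‖jacobiTheta₂_term (2 * k) z (τ / 2)‖ :=
    ((hs z).comp_injective (i := fun k : ℤ => 2 * k) fun a b h => by dsimp only at h; omega).norm
  have ho (z : ℂ) : Summable fun k : ℤ => ‖jacobiTheta₂_term (2 * k + 1) z (τ / 2)‖ :=
    ((hs z).comp_injective (i := fun k : ℤ => 2 * k + 1)
      fun a b h => by dsimp only at h; omega).norm
  have h₁ := (summable_mul_of_summable_norm (he x) (ho y)).hasSum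
  have h₂ := (summable_mul_of_summable_norm (ho x) (he y)).hasSum.neg
  rw [← tsum_mul_tsum_of_summable_norm (he x) (ho y)] at h₁
  rw [← tsum_mul_tsum_of_summable_norm (ho x) (he y)] at h₂
  rw [theta_eq_neg_tsum, theta_eq_neg_tsum, neg_mul_neg, tsum_mul_tsum_of_summable_norm
    (summable_thetaTerm hτ _).norm (summable_thetaTerm hτ _).norm,
    ← thetaIndexEquiv.tsum_eq, sub_eq_add_neg (thetaEven τ x * _)]
  refine HasSum.tsum_eq (HasSum.sum ?_ ?_)
  · exact h₁.congr_fun fun p => thetaTerm_mul_of_even_add τ x y p.1 p.2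
  · exact h₂.congr_fun fun p => thetaTerm_mul_of_odd_add τ x y p.1 p.2

theorem theta_three_term {τ : ℂ} (hτ : 0 < τ.im) (x y z w : ℂ) :
    theta τ (x + y) * theta τ (x - y) * (theta τ (z + w) * theta τ (z - w)) =
      theta τ (x + z) * theta τ (x - z) * (theta τ (y + w) * theta τ (y - w)) -
      theta τ (x + w) * theta τ (x - w) * (theta τ (y + z) * theta τ (y - z)) := by
  simp only [theta_add_mul_theta_sub hτ]
  ring

theorem theta_zero {τ : ℂ} (hτ : 0 < τ.im) : theta τ 0 = 0 := by
  have h := theta_add_mul_theta_sub hτ 0 0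
  rw [add_zero, sub_zero, mul_comm (thetaOdd τ 0), sub_self] at h
  exact mul_self_eq_zero.1 h

theorem theta_neg {τ : ℂ} (hτ : 0 < τ.im) (u : ℂ) : theta τ (-u) = -theta τ u := by
  by_cases hu : ∃ v, theta τ v ≠ 0
  · obtain ⟨v, hv⟩ := hu
    have h₁ := theta_add_mul_theta_sub hτ ((v + u) / 2) ((v - u) / 2)
    have h₂ := theta_add_mul_theta_sub hτ ((v - u) / 2) ((v + u) / 2)
    rw [show (v + u) / 2 + (v - u) / 2 = v by ring,
      show (v + u) / 2 - (v - u) / 2 = u by ring] at h₁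
    rw [show (v - u) / 2 + (v + u) / 2 = v by ring,
      show (v - u) / 2 - (v + u) / 2 = -u by ring] at h₂
    refine mul_left_cancel₀ hv ?_
    linear_combination h₁ + h₂
  · push Not at hu
    rw [hu, hu, neg_zero]

/-- The derivative of `theta_three_term` along the diagonal `x = y`. -/
theorem theta_three_term_deriv {τ : ℂ} (hτ : 0 < τ.im) (y z w : ℂ) :
    theta' τ 0 * theta τ (y + y) * (theta τ (z + w) * theta τ (z - w)) =
      (theta' τ (y + z) * theta τ (y - z) + theta τ (y + z) * theta' τ (y - z)) *
        (theta τ (y + w) * theta τ (y - w)) -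
      (theta' τ (y + w) * theta τ (y - w) + theta τ (y + w) * theta' τ (y - w)) *
        (theta τ (y + z) * theta τ (y - z)) := by
  have hd (c : ℂ) : HasDerivAt (fun x => theta τ (x + c) * theta τ (x - c))
      (theta' τ (y + c) * theta τ (y - c) + theta τ (y + c) * theta' τ (y - c)) y :=
    ((differentiable_theta hτ _).hasDerivAt.comp_add_const y c).mul
      ((differentiable_theta hτ _).hasDerivAt.comp_sub_const y c)
  have h := ((hd y).mul_const (theta τ (z + w) * theta τ (z - w))).unique
    ((((hd z).mul_const (theta τ (y + w) * theta τ (y - w))).sub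
      ((hd w).mul_const (theta τ (y + z) * theta τ (y - z)))).congr_of_eventuallyEq
      (.of_forall fun x => theta_three_term hτ x y z w))
  rw [sub_self, theta_zero hτ] at h
  linear_combination h

theorem theta_four_term_identity (τ : ℂ) (hτ : 0 < τ.im) (lam tp tj tq : ℂ)
    (h1 : theta τ lam ≠ 0) (h2 : theta τ (lam - tp + tq) ≠ 0)
    (h3 : theta τ (tp - tj) ≠ 0) (h4 : theta τ (tj - tq) ≠ 0)
    (h5 : theta τ (tp - tq - lam) ≠ 0) (h6 : theta τ (tp - tq) ≠ 0) :
    theta' τ 0 * theta τ (lam - tp + tj) * theta τ (lam - tj + tq) * theta τ (tp - tq) /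
        (theta τ lam * theta τ (lam - tp + tq) * theta τ (tp - tj) * theta τ (tj - tq)) =
      rho τ (tp - tj) + rho τ (tj - tq) - rho τ (tp - tq - lam) - rho τ lam := by
  have h := theta_three_term_deriv hτ ((tp - tq) / 2) ((tp - tj - (tj - tq)) / 2)
    ((tp - tq) / 2 - lam)
  rw [add_halves,
    show (tp - tj - (tj - tq)) / 2 + ((tp - tq) / 2 - lam) = -(lam - tp + tj) by ring,
    show (tp - tj - (tj - tq)) / 2 - ((tp - tq) / 2 - lam) = lam - tj + tq by ring,
    show (tp - tq) / 2 + (tp - tj - (tj - tq)) / 2 = tp - tj by ring,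
    show (tp - tq) / 2 - (tp - tj - (tj - tq)) / 2 = tj - tq by ring,
    show (tp - tq) / 2 + ((tp - tq) / 2 - lam) = tp - tq - lam by ring,
    show (tp - tq) / 2 - ((tp - tq) / 2 - lam) = lam by ring, theta_neg hτ] at h
  have h7 : theta τ (lam - tp + tq) = -theta τ (tp - tq - lam) := by
    rw [← theta_neg hτ]
    ring_nf
  rw [h7, rho, rho, rho, rho]
  field_simp
  linear_combination h
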